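/- (Weak-type estimate for the variable order Riesz potential) Let Ω ⊆ ℝ^n be bounded open, p log-Hölder continuous with 1 ≤ p⁻ ≤ p⁺ < ∞, α log-Hölder continuous with α⁻ > 0 and sup(αp) < n, and set p^#_α(x) := n p(x)/(n − α(x)p(x)). Then there exists a constant c such that for every f ∈ L^{p(·)}(Ω) with ‖f‖_{p(·)} ≤ 1 and every t > 0: ∫_{{x ∈ Ω : I_{α(·)} f(x) > t}} t^{p^#_α(x)} dx ≤ c ∫_Ω |f(y)|^{p(y)} dy + c |{x ∈ Ω : 0 < |f(x)| ≤ 1}|. -/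

import Mathlib

open MeasureTheory Metric

/-- `g` is log-Hölder continuous on `U` with constant `c`. -/
def LogHolderWith {n : ℕ} (c : ℝ) (g : EuclideanSpace ℝ (Fin n) → ℝ)
    (U : Set (EuclideanSpace ℝ (Fin n))) : Prop :=
  ∀ ⦃x⦄, x ∈ U → ∀ ⦃y⦄, y ∈ U → x ≠ y →
    |g x - g y| ≤ c / Real.log (Real.exp 1 + 1 / dist x y)

/-- The Luxemburg norm on the variable exponent Lebesgue space `L^{p(·)}(Ω)`. -/
noncomputable def luxNorm {n : ℕ} (p : EuclideanSpace ℝ (Fin n) → ℝ)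
    (Ω : Set (EuclideanSpace ℝ (Fin n))) (f : EuclideanSpace ℝ (Fin n) → ℝ) : ℝ :=
  sInf {l : ℝ | 0 < l ∧ ∫⁻ x in Ω, ENNReal.ofReal ((|f x| / l) ^ p x) ≤ 1}

/-- The variable order Riesz potential `I_{α(·)} f`. -/
noncomputable def riesz {n : ℕ} (Ω : Set (EuclideanSpace ℝ (Fin n)))
    (α : EuclideanSpace ℝ (Fin n) → ℝ) (f : EuclideanSpace ℝ (Fin n) → ℝ)
    (x : EuclideanSpace ℝ (Fin n)) : ENNReal :=
  ∫⁻ y in Ω, ENNReal.ofReal (|f y| / dist x y ^ ((n : ℝ) - α x))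

/-- Variable order fractional maximal function. -/
noncomputable def fracMax {n : ℕ} (Ω : Set (EuclideanSpace ℝ (Fin n)))
    (α : EuclideanSpace ℝ (Fin n) → ℝ) (f : EuclideanSpace ℝ (Fin n) → ℝ)
    (x : EuclideanSpace ℝ (Fin n)) : ENNReal :=
  ⨆ (r : ℝ) (_ : 0 < r),
    (ENNReal.ofReal (r ^ α x) / volume (Metric.ball x r)) *
      ∫⁻ y in Metric.ball x r ∩ Ω, ENNReal.ofReal |f y|

section rwHelpers

open MeasureTheory Metric Set

noncomputable def rwPhi (n : ℕ) (a b : ℝ) (ρ : ℝ) : ℝ :=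
  if ρ < 1 then ρ ^ (a - n) else ρ ^ (-b - n)

noncomputable def rwPsi (n : ℕ) (a : ℝ) (ρ : ℝ) : ℝ :=
  if ρ < 1 then ρ ^ (a - n) else 0

lemma rwPhi_meas (n : ℕ) (a b : ℝ) : Measurable (rwPhi n a b) := by
  unfold rwPhi
  exact Measurable.ite measurableSet_Iio (by fun_prop) (by fun_prop)

lemma rwPsi_meas (n : ℕ) (a : ℝ) : Measurable (rwPsi n a) := by
  unfold rwPsi
  exact Measurable.ite measurableSet_Iio (by fun_prop) (by fun_prop)

lemma rwPsi_le_Phi (n : ℕ) (a b : ℝ) {ρ : ℝ} (h : 0 ≤ ρ) : rwPsi n a ρ ≤ rwPhi n a b ρ := by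
  unfold rwPsi rwPhi
  split_ifs
  · exact le_rfl
  · positivity

lemma rwPsi_anti {n : ℕ} {a : ℝ} (ha : a ≤ n) {ρ σ : ℝ} (h : 0 < ρ) (h' : ρ ≤ σ) :
    rwPsi n a σ ≤ rwPsi n a ρ := by
  unfold rwPsi
  split_ifs with h1 h2
  · exact Real.rpow_le_rpow_of_nonpos h h' (by linarith)
  · linarith
  · positivity
  · exact le_rfl

lemma rwPhi_integrable {n : ℕ} (hn : 1 ≤ n) {a b : ℝ} (ha : 0 < a) (hb : 0 < b) :
    Integrable (fun z : EuclideanSpace ℝ (Fin n) => rwPhi n a b ‖z‖) := by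
  have : Nonempty (Fin n) := ⟨⟨0, hn⟩⟩
  have : Nontrivial (EuclideanSpace ℝ (Fin n)) := by
    apply Module.nontrivial_of_finrank_pos (R := ℝ)
    rw [finrank_euclideanSpace, Fintype.card_fin]; omega
  rw [integrable_fun_norm_addHaar volume (f := rwPhi n a b)]
  simp only [finrank_euclideanSpace, Fintype.card_fin, smul_eq_mul]
  have hun : Ioi (0:ℝ) = Ioo 0 1 ∪ Ici 1 := by
    ext x; simp
  rw [hun]
  have hpow : ∀ (x e : ℝ), 0 < x → x ^ (n-1) * x ^ (e - n) = x ^ (e - 1) := by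
    intro x e hx
    rw [← Real.rpow_natCast, ← Real.rpow_add hx]
    congr 1
    rw [Nat.cast_sub hn]; push_cast; ring
  apply IntegrableOn.union
  · have : IntegrableOn (fun x : ℝ => x ^ (a - 1)) (Ioo 0 1) := by
      rw [intervalIntegral.integrableOn_Ioo_rpow_iff (by norm_num)]
      linarith
    refine this.congr_fun ?_ measurableSet_Ioo
    intro x hx
    simp only [rwPhi, hx.2, if_true]
    exact (hpow x a hx.1).symm
  · have : IntegrableOn (fun x : ℝ => x ^ (-b - 1)) (Ici 1) := by
      rw [integrableOn_Ici_iff_integrableOn_Ioi]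
      rw [integrableOn_Ioi_rpow_iff (by norm_num)]
      linarith
    refine this.congr_fun ?_ measurableSet_Ici
    intro x hx
    have hx' : (1:ℝ) ≤ x := hx
    simp only [rwPhi, not_lt.mpr hx', if_false]
    exact (hpow x (-b) (by linarith)).symm

lemma rw_scale {n : ℕ} (φ : ℝ → ENNReal) (hφ : Measurable φ) (x : EuclideanSpace ℝ (Fin n))
    {r : ℝ} (hr : 0 < r) :
    ∫⁻ y, φ (dist x y / r) = ENNReal.ofReal (r ^ n) *
      ∫⁻ z : EuclideanSpace ℝ (Fin n), φ ‖z‖ := by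
  have h1 : ∫⁻ y, φ (dist x y / r) = ∫⁻ y : EuclideanSpace ℝ (Fin n), φ (‖r⁻¹ • y‖) := by
    rw [← lintegral_sub_left_eq_self _ x]
    congr 1; ext y
    simp only [dist_eq_norm, sub_sub_cancel, norm_smul, norm_inv, Real.norm_eq_abs, abs_of_pos hr]
    congr 1
    field_simp
  have h2 := lintegral_map (μ := (volume : Measure (EuclideanSpace ℝ (Fin n))))
    (f := fun z => φ ‖z‖) (g := fun y => r⁻¹ • y) (by fun_prop) (by fun_prop)
  rw [h1, ← h2, Measure.map_addHaar_smul _ (by positivity)]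
  simp [abs_of_pos hr]

lemma rw_swap {n : ℕ} (φ : ℝ → ENNReal) (hφ : Measurable φ) 
    (W : EuclideanSpace ℝ (Fin n) → ENNReal) (hW : Measurable W)
    (r : EuclideanSpace ℝ (Fin n) → ℝ) (hr : Measurable r) (hr0 : ∀ y, 0 < r y) :
    ∫⁻ x, ∫⁻ y, W y * φ (dist x y / r y) =
      ∫⁻ y, W y * (ENNReal.ofReal (r y ^ n) * ∫⁻ z : EuclideanSpace ℝ (Fin n), φ ‖z‖) := by
  rw [lintegral_lintegral_swap]
  · congr 1; ext y
    rw [lintegral_const_mul _ (by fun_prop)]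
    congr 1
    rw [← rw_scale φ hφ y (hr0 y)]
    simp_rw [dist_comm]
  · apply Measurable.aemeasurable
    unfold Function.uncurry
    fun_prop

lemma rw_H_meas {n : ℕ} (φ : ℝ → ENNReal) (hφ : Measurable φ) 
    (W : EuclideanSpace ℝ (Fin n) → ENNReal) (hW : Measurable W)
    (r : EuclideanSpace ℝ (Fin n) → ℝ) (hr : Measurable r) :
    Measurable (fun x => ∫⁻ y, W y * φ (dist x y / r y)) := by
  apply Measurable.lintegral_prod_right' (f := fun q : _ × _ => W q.2 * φ (dist q.1 q.2 / r q.2))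
  fun_prop

lemma rw_minorant {E : Type*} [MeasurableSpace E] (μ : Measure E) [IsFiniteMeasure μ]
    (F : E → ℝ) (hF : ∀ x, 0 ≤ F x) :
    ∃ g : E → ℝ, Measurable g ∧ (∀ x, 0 ≤ g x) ∧ (∀ x, g x ≤ F x) ∧
      ∀ k : E → ℝ, Measurable k → (∀ x, 0 ≤ k x) → (∀ x, k x ≤ F x) → ∀ᵐ x ∂μ, k x ≤ g x := by
  obtain ⟨h, hm, hle, hint⟩ := exists_measurable_le_lintegral_eq (μ := μ)
    (fun x => ENNReal.ofReal (F x / (1 + F x)))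
  have hφ1 : ∀ u : ℝ, 0 ≤ u → u / (1 + u) < 1 := fun u hu => by
    rw [div_lt_one (by linarith)]; linarith
  have hφ0 : ∀ u : ℝ, 0 ≤ u → 0 ≤ u / (1 + u) := fun u hu => by positivity
  have hfin : ∀ x, h x ≠ ⊤ := fun x => ne_top_of_le_ne_top ENNReal.ofReal_ne_top (hle x)
  have hr : ∀ x, (h x).toReal ≤ F x / (1 + F x) := fun x =>
    ENNReal.toReal_le_of_le_ofReal (hφ0 _ (hF x)) (hle x)
  have hr1 : ∀ x, (h x).toReal < 1 := fun x => (hr x).trans_lt (hφ1 _ (hF x))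
  have hr0 : ∀ x, 0 ≤ (h x).toReal := fun x => ENNReal.toReal_nonneg
  refine ⟨fun x => (h x).toReal / (1 - (h x).toReal), by fun_prop, ?_, ?_, ?_⟩
  · intro x
    exact div_nonneg (hr0 x) (by linarith [hr1 x])
  · intro x
    have h1 := hr x
    have h2 := hr1 x
    have h3 := hF x
    rw [le_div_iff₀ (by linarith)] at h1
    rw [div_le_iff₀ (by linarith)]
    linarith
  · intro k hk hk0 hkF
    have hsup : h ≤ᵐ[μ] fun x => max (h x) (ENNReal.ofReal (k x / (1 + k x))) :=
      ae_of_all _ fun x => le_max_left _ _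
    have hlt : ∫⁻ x, h x ∂μ ≠ ⊤ := by
      have : ∫⁻ x, h x ∂μ ≤ ∫⁻ x, 1 ∂μ := by
        apply lintegral_mono
        intro x
        refine (hle x).trans ?_
        simp only [ENNReal.ofReal_le_one]
        exact (hφ1 _ (hF x)).le
      refine ne_top_of_le_ne_top ?_ this
      simp
    have hint2 : ∫⁻ x, max (h x) (ENNReal.ofReal (k x / (1 + k x))) ∂μ ≤ ∫⁻ x, h x ∂μ := by
      rw [← hint]
      apply lintegral_mono
      intro x
      refine max_le (hle x) (ENNReal.ofReal_le_ofReal ?_)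
      have h1 := hkF x
      have h2 := hk0 x
      have h3 := hF x
      rw [div_le_div_iff₀ (by linarith) (by linarith)]
      nlinarith
    have hae := ae_eq_of_ae_le_of_lintegral_le hsup hlt (by fun_prop) hint2
    filter_upwards [hae] with x hx
    have h1 : ENNReal.ofReal (k x / (1 + k x)) ≤ h x := by
      rw [hx]; exact le_max_right _ _
    have h2 : k x / (1 + k x) ≤ (h x).toReal := (ENNReal.ofReal_le_iff_le_toReal (hfin x)).1 h1
    have h3 := hr1 x
    have h4 := hk0 x
    rw [div_le_iff₀ (by linarith)] at h2
    rw [le_div_iff₀ (by linarith)]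
    linarith

lemma rw_reduce {n : ℕ} (hn : 1 ≤ n) (Ω : Set (EuclideanSpace ℝ (Fin n))) (hΩo : IsOpen Ω)
    (hΩb : Bornology.IsBounded Ω) (α : EuclideanSpace ℝ (Fin n) → ℝ)
    (hα : ∀ x ∈ Ω, α x < n) (f : EuclideanSpace ℝ (Fin n) → ℝ) :
    ∃ g : EuclideanSpace ℝ (Fin n) → ℝ, Measurable g ∧ (∀ x, 0 ≤ g x) ∧ (∀ x, g x ≤ |f x|) ∧
      (∀ x ∈ Ω, riesz Ω α f x ≤ riesz Ω α g x) ∧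
      volume {x | x ∈ Ω ∧ 0 < g x ∧ g x < 1} ≤ volume {x | x ∈ Ω ∧ 0 < |f x| ∧ |f x| ≤ 1} := by
  have : Nonempty (Fin n) := ⟨⟨0, hn⟩⟩
  have : Nontrivial (EuclideanSpace ℝ (Fin n)) := by
    apply Module.nontrivial_of_finrank_pos (R := ℝ)
    rw [finrank_euclideanSpace, Fintype.card_fin]; omega
  have : IsFiniteMeasure (volume.restrict Ω) := ⟨by
    rw [Measure.restrict_apply_univ]; exact hΩb.measure_lt_top⟩
  obtain ⟨g, hgm, hg0, hgf, hmax⟩ := rw_minorant (volume.restrict Ω) (fun x => |f x|)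
    (fun x => abs_nonneg _)
  refine ⟨g, hgm, hg0, hgf, ?_, ?_⟩
  · intro x hx
    unfold riesz
    obtain ⟨h, hm, hle, hint⟩ := exists_measurable_le_lintegral_eq (μ := volume.restrict Ω)
      (fun y => ENNReal.ofReal (|f y| / dist x y ^ ((n : ℝ) - α x)))
    rw [hint]
    have he : (0:ℝ) < n - α x := by linarith [hα x hx]
    have hfin : ∀ x, h x ≠ ⊤ := fun x => ne_top_of_le_ne_top ENNReal.ofReal_ne_top (hle x)
    have hk := hmax (fun y => (h y).toReal * dist x y ^ ((n : ℝ) - α x)) (by fun_prop)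
      (fun y => by positivity) (fun y => by
        by_cases hxy : dist x y = 0
        · simp [hxy, Real.zero_rpow he.ne']
        · have hd : 0 < dist x y := lt_of_le_of_ne dist_nonneg (Ne.symm hxy)
          have h1 : (h y).toReal ≤ |f y| / dist x y ^ ((n : ℝ) - α x) :=
            ENNReal.toReal_le_of_le_ofReal (by positivity) (hle y)
          rwa [le_div_iff₀ (by positivity)] at h1)
    have hne : ∀ᵐ y ∂(volume.restrict Ω), y ≠ x := by
      apply ae_restrict_of_ae
      simp [ae_iff]
    apply lintegral_mono_ae
    filter_upwards [hk, hne] with y hy hyx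
    have hd : 0 < dist x y := dist_pos.2 (Ne.symm hyx)
    rw [← le_div_iff₀ (by positivity)] at hy
    rw [abs_of_nonneg (hg0 y)]
    exact (ENNReal.le_ofReal_iff_toReal_le (hfin y) (div_nonneg (hg0 y) (by positivity))).2 hy
  · set B := {x | x ∈ Ω ∧ 0 < |f x| ∧ |f x| ≤ 1} with hB
    set T := toMeasurable volume B with hT
    have hTm : MeasurableSet T := measurableSet_toMeasurable _ _
    have hGm : MeasurableSet {x | x ∈ Ω ∧ 0 < g x ∧ g x < 1} :=
      hΩo.measurableSet.inter ((measurableSet_lt measurable_const hgm).inter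
        (measurableSet_lt hgm measurable_const))
    have hD : MeasurableSet ({x | x ∈ Ω ∧ 0 < g x ∧ g x < 1} \ T) := hGm.diff hTm
    classical
    have hk := hmax (({x | x ∈ Ω ∧ 0 < g x ∧ g x < 1} \ T).piecewise (fun _ => 1) g)
      (Measurable.piecewise hD measurable_const hgm)
      (fun y => by
        by_cases hy : y ∈ ({x | x ∈ Ω ∧ 0 < g x ∧ g x < 1} \ T)
        · rw [Set.piecewise_eq_of_mem _ _ _ hy]; norm_num
        · rw [Set.piecewise_eq_of_notMem _ _ _ hy]; exact hg0 y)
      (fun y => by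
        by_cases hy : y ∈ ({x | x ∈ Ω ∧ 0 < g x ∧ g x < 1} \ T)
        · rw [Set.piecewise_eq_of_mem _ _ _ hy]
          by_contra hc
          simp only [not_le] at hc
          exact hy.2 (subset_toMeasurable _ _ ⟨hy.1.1, hy.1.2.1.trans_le (hgf y), hc.le⟩)
        · rw [Set.piecewise_eq_of_notMem _ _ _ hy]; exact hgf y)
    rw [ae_restrict_iff' hΩo.measurableSet] at hk
    rw [← measure_toMeasurable B]
    apply measure_mono_ae
    filter_upwards [hk] with y hy
    intro hyG
    by_contra hyT
    have hyD : y ∈ ({x | x ∈ Ω ∧ 0 < g x ∧ g x < 1} \ T) := ⟨hyG, hyT⟩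
    have := hy hyG.1
    rw [Set.piecewise_eq_of_mem _ _ _ hyD] at this
    have h2 : g y < 1 := hyG.2.2
    linarith

lemma rw_lux {n : ℕ} (Ω : Set (EuclideanSpace ℝ (Fin n))) (hΩo : IsOpen Ω)
    (p : EuclideanSpace ℝ (Fin n) → ℝ)
    (hp1 : ∀ x ∈ Ω, 1 ≤ p x) (pp : ℝ) (hpp : ∀ x ∈ Ω, p x ≤ pp)
    (f : EuclideanSpace ℝ (Fin n) → ℝ) (hf : luxNorm p Ω f ≤ 1) :
    ∫⁻ y in Ω, ENNReal.ofReal (|f y| ^ p y) = ⊤ ∨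
      ∫⁻ y in Ω, ENNReal.ofReal (|f y| ^ p y) ≤ ENNReal.ofReal (2 ^ pp) := by
  by_cases hI : ∫⁻ y in Ω, ENNReal.ofReal (|f y| ^ p y) = ⊤
  · exact Or.inl hI
  right
  have hne : {l : ℝ | 0 < l ∧ ∫⁻ x in Ω, ENNReal.ofReal ((|f x| / l) ^ p x) ≤ 1}.Nonempty := by
    set I := ∫⁻ y in Ω, ENNReal.ofReal (|f y| ^ p y) with hIdef
    have hl1 : 1 ≤ max 1 I.toReal := le_max_left _ _
    refine ⟨max 1 I.toReal, by positivity, ?_⟩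
    set l := max 1 I.toReal with hl
    have h1 : ∫⁻ x in Ω, ENNReal.ofReal ((|f x| / l) ^ p x) ≤
        ∫⁻ x in Ω, ENNReal.ofReal l⁻¹ * ENNReal.ofReal (|f x| ^ p x) := by
      apply setLIntegral_mono' hΩo.measurableSet
      intro x hx
      rw [← ENNReal.ofReal_mul (by positivity)]
      apply ENNReal.ofReal_le_ofReal
      rw [Real.div_rpow (abs_nonneg _) (by positivity), div_eq_inv_mul]
      gcongr
      calc l = l ^ (1:ℝ) := (Real.rpow_one l).symm
        _ ≤ l ^ p x := Real.rpow_le_rpow_of_exponent_le hl1 (hp1 x hx)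
    refine h1.trans ?_
    rw [lintegral_const_mul' _ _ ENNReal.ofReal_ne_top, ← hIdef,
      ← ENNReal.ofReal_toReal hI, ← ENNReal.ofReal_mul (by positivity)]
    rw [ENNReal.ofReal_le_one, inv_mul_le_iff₀ (by positivity), mul_one]
    exact le_max_right _ _
  obtain ⟨l, ⟨hl0, hl⟩, hl2⟩ := exists_lt_of_csInf_lt hne
    (lt_of_le_of_lt hf (by norm_num : (1:ℝ) < 2))
  calc ∫⁻ y in Ω, ENNReal.ofReal (|f y| ^ p y)
      ≤ ∫⁻ x in Ω, ENNReal.ofReal (2 ^ pp) * ENNReal.ofReal ((|f x| / l) ^ p x) := by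
        apply setLIntegral_mono' hΩo.measurableSet
        intro x hx
        rw [← ENNReal.ofReal_mul (by positivity)]
        apply ENNReal.ofReal_le_ofReal
        have : |f x| ^ p x = l ^ p x * (|f x| / l) ^ p x := by
          rw [← Real.mul_rpow hl0.le (by positivity)]
          congr 1; field_simp
        rw [this]
        gcongr
        calc l ^ p x ≤ 2 ^ p x := by
              apply Real.rpow_le_rpow hl0.le hl2.le; linarith [hp1 x hx]
          _ ≤ 2 ^ pp := Real.rpow_le_rpow_of_exponent_le (by norm_num) (hpp x hx)
    _ ≤ ENNReal.ofReal (2 ^ pp) := by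
        rw [lintegral_const_mul' _ _ ENNReal.ofReal_ne_top]
        exact mul_le_of_le_one_right' hl

lemma rw_lh {n : ℕ} {c : ℝ} {g : EuclideanSpace ℝ (Fin n) → ℝ}
    {U : Set (EuclideanSpace ℝ (Fin n))} (h : LogHolderWith c g U)
    {x y : EuclideanSpace ℝ (Fin n)} (hx : x ∈ U) (hy : y ∈ U) {m M : ℝ} (hm : 0 < m)
    (hd : dist x y ≤ m) (hM : m ≤ M) (hM1 : 1 ≤ M) :
    |Real.log m| * |g x - g y| ≤ |c| * (1 + Real.log M) ∧ |g x - g y| ≤ |c| := by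
  have hlM : 0 ≤ Real.log M := Real.log_nonneg hM1
  by_cases hxy : x = y
  · subst hxy; simp; positivity
  have hd0 : 0 < dist x y := dist_pos.2 hxy
  have h1 := h hx hy hxy
  set Lg := Real.log (Real.exp 1 + 1 / dist x y) with hLg
  have hL1 : 1 ≤ Lg := by
    rw [hLg, Real.le_log_iff_exp_le (by positivity)]
    have : 0 ≤ 1 / dist x y := by positivity
    linarith
  have hLm : -Real.log m ≤ Lg := by
    rw [← Real.log_inv, hLg]
    apply Real.log_le_log (by positivity)
    have : m⁻¹ ≤ 1 / dist x y := by
      rw [one_div]; gcongr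
    linarith [Real.exp_pos 1]
  have h2 : |g x - g y| * Lg ≤ |c| := by
    rw [le_div_iff₀ (by linarith)] at h1
    exact h1.trans (le_abs_self c)
  have h3 : |g x - g y| ≤ |c| := by nlinarith [abs_nonneg (g x - g y)]
  refine ⟨?_, h3⟩
  have hm2 : Real.log m ≤ Real.log M := Real.log_le_log hm hM
  have habs : |Real.log m| ≤ Lg + Real.log M := by
    rw [abs_le]; constructor <;> linarith
  calc |Real.log m| * |g x - g y| ≤ (Lg + Real.log M) * |g x - g y| := by gcongr
    _ = |g x - g y| * Lg + Real.log M * |g x - g y| := by ring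
    _ ≤ |c| + Real.log M * |c| := by gcongr
    _ = _ := by ring

lemma rw_lh_cont {n : ℕ} {c : ℝ} {g : EuclideanSpace ℝ (Fin n) → ℝ}
    {U : Set (EuclideanSpace ℝ (Fin n))} (h : LogHolderWith c g U) : ContinuousOn g U := by
  rw [Metric.continuousOn_iff]
  intro x hx ε hε
  refine ⟨Real.exp (-(|c| / ε + 1)), Real.exp_pos _, ?_⟩
  intro y hy hd
  by_cases hxy : y = x
  · subst hxy; simpa using hε
  have hd0 : 0 < dist y x := dist_pos.2 hxy
  have h1 := h hy hx hxy
  have h2 : |c| / ε + 1 ≤ Real.log (Real.exp 1 + 1 / dist y x) := by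
    have h3 : Real.log (dist y x) ≤ -(|c| / ε + 1) := by
      rw [Real.log_le_iff_le_exp hd0]; exact hd.le
    have h4 : Real.log (dist y x)⁻¹ ≤ Real.log (Real.exp 1 + 1 / dist y x) := by
      apply Real.log_le_log (by positivity)
      rw [one_div]; linarith [Real.exp_pos 1]
    rw [Real.log_inv] at h4
    linarith
  have h5 : 0 ≤ |c| / ε := by positivity
  rw [Real.dist_eq]
  refine h1.trans_lt ?_
  rw [div_lt_iff₀ (by linarith)]
  calc c ≤ |c| := le_abs_self c
    _ = ε * (|c| / ε) := by field_simp
    _ < _ := by gcongr; linarith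

lemma rw_young {a s q : ℝ} (ha : 0 ≤ a) (hs : 0 < s) (hq : 1 ≤ q) :
    a ≤ s + a ^ q * s ^ (1 - q) := by
  by_cases h : a ≤ s
  · have : 0 ≤ a ^ q * s ^ (1 - q) := by positivity
    linarith
  · push Not at h
    have ha' : 0 < a := hs.trans h
    have h1 : a ^ (1 - q) ≤ s ^ (1 - q) := Real.rpow_le_rpow_of_nonpos hs h.le (by linarith)
    have h2 : a = a ^ q * a ^ (1 - q) := by
      rw [← Real.rpow_add ha']; simp
    have h3 : a ^ q * a ^ (1 - q) ≤ a ^ q * s ^ (1 - q) := by gcongr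
    linarith

lemma rw_young_m {n : ℕ} {a m px py C : ℝ} (ha : 0 ≤ a) (hm : 0 < m) (hpx : 1 ≤ px)
    (hpy : 1 ≤ py) (hC : |Real.log m| * |px - py| ≤ C) :
    a ≤ m ^ (-((n:ℝ) / px)) + Real.exp (n * C) * m ^ ((n:ℝ) - n / px) * a ^ py := by
  have h := rw_young ha (Real.rpow_pos_of_pos hm (-((n:ℝ) / px))) hpy
  refine h.trans ?_
  have hpx0 : 0 < px := by linarith
  have e1 : (m ^ (-((n:ℝ) / px))) ^ (1 - py) = m ^ ((n:ℝ)/px * (py - px)) * m ^ ((n:ℝ) - n / px) := by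
    rw [← Real.rpow_mul hm.le, ← Real.rpow_add hm]
    congr 1; field_simp; ring
  have e2 : m ^ ((n:ℝ)/px * (py - px)) ≤ Real.exp (n * C) := by
    rw [Real.rpow_def_of_pos hm]
    apply Real.exp_le_exp.2
    have hnp : (n:ℝ)/px ≤ n := div_le_self (by positivity) hpx
    have hnp0 : 0 ≤ (n:ℝ)/px := by positivity
    calc Real.log m * ((n:ℝ)/px * (py - px)) ≤ |Real.log m * ((n:ℝ)/px * (py - px))| := le_abs_self _
      _ = (n:ℝ)/px * (|Real.log m| * |px - py|) := by
          rw [abs_mul, abs_mul, abs_of_nonneg hnp0, abs_sub_comm py px]; ring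
      _ ≤ n * C := by gcongr
  rw [e1]
  have : a ^ py * (m ^ ((n:ℝ)/px * (py - px)) * m ^ ((n:ℝ) - n / px)) =
    m ^ ((n:ℝ)/px * (py - px)) * m ^ ((n:ℝ) - n / px) * a ^ py := by ring
  rw [this]
  gcongr

lemma rw_point {n : ℕ} {am b δ u α px py c1 c2 g : ℝ} (hδ : 0 < δ) (hu : 0 < u)
    (hα : am ≤ α) (hb : b ≤ n / px - α) (hb0 : 0 < b) (hpx : 1 ≤ px) (hpy : 1 ≤ py)
    (H1 : δ ≤ u → |Real.log u| * |px - py| ≤ c1)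
    (H2 : u < δ → |Real.log δ| * |px - py| ≤ c2) (hg : 0 ≤ g) :
    g / u ^ ((n:ℝ) - α) ≤ δ ^ (-((n:ℝ) / px - α)) * ((δ ^ n)⁻¹ * rwPhi n am b (u / δ)
      + Real.exp (n * c1) * g ^ py + Real.exp (n * c2) * (g ^ py * rwPsi n am (u / δ))) := by
  have hinv : g / u ^ ((n:ℝ) - α) = g * u ^ (α - n) := by
    rw [div_eq_mul_inv, ← Real.rpow_neg hu.le]; congr 2; ring
  have hδn : (δ ^ n)⁻¹ = δ ^ (-(n:ℝ)) := by
    rw [Real.rpow_neg hδ.le, Real.rpow_natCast]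
  have huδ : 0 < u / δ := by positivity
  rw [hinv, hδn]
  rcases lt_or_ge u δ with h | h
  · have h1 : u / δ < 1 := by rwa [div_lt_one hδ]
    have hY := rw_young_m (n := n) hg hδ hpx hpy (H2 h)
    simp only [rwPhi, rwPsi, h1, if_true]
    have e1 : u ^ (α - n) ≤ δ ^ (α - n) * (u / δ) ^ (am - n) := by
      have : u ^ (α - n) = δ ^ (α - n) * (u / δ) ^ (α - n) := by
        rw [← Real.mul_rpow hδ.le huδ.le]; congr 1; field_simp
      rw [this]
      gcongr 1
      exact Real.rpow_le_rpow_of_exponent_ge huδ h1.le (by linarith)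
    have e2 : δ ^ (-((n:ℝ) / px)) * δ ^ (α - n) = δ ^ (-((n:ℝ) / px - α)) * δ ^ (-(n:ℝ)) := by
      rw [← Real.rpow_add hδ, ← Real.rpow_add hδ]; congr 1; ring
    have e3 : δ ^ ((n:ℝ) - n / px) * δ ^ (α - n) = δ ^ (-((n:ℝ) / px - α)) := by
      rw [← Real.rpow_add hδ]; congr 1; ring
    calc g * u ^ (α - n) ≤ (δ ^ (-((n:ℝ) / px)) + Real.exp (n * c2) * δ ^ ((n:ℝ) - n / px) * g ^ py)
          * (δ ^ (α - n) * (u / δ) ^ (am - n)) := by gcongr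
      _ = (δ ^ (-((n:ℝ) / px)) * δ ^ (α - n)) * (u / δ) ^ (am - n) +
          Real.exp (n * c2) * (δ ^ ((n:ℝ) - n / px) * δ ^ (α - n)) * (g ^ py * (u / δ) ^ (am - n)) := by
          ring
      _ = δ ^ (-((n:ℝ) / px - α)) * (δ ^ (-(n:ℝ)) * (u / δ) ^ (am - n) + 0 +
          Real.exp (n * c2) * (g ^ py * (u / δ) ^ (am - n))) := by
          rw [e2, e3]; ring
      _ ≤ _ := by gcongr; positivity
  · have h1 : ¬ u / δ < 1 := by rw [not_lt, one_le_div hδ]; exact h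
    have hY := rw_young_m (n := n) hg hu hpx hpy (H1 h)
    simp only [rwPhi, rwPsi, h1, if_false]
    have e2 : u ^ (-((n:ℝ) / px)) * u ^ (α - n) ≤
        δ ^ (-((n:ℝ) / px - α)) * δ ^ (-(n:ℝ)) * (u / δ) ^ (-b - n) := by
      have : u ^ (-((n:ℝ) / px)) * u ^ (α - n) = δ ^ (-((n:ℝ) / px - α)) * δ ^ (-(n:ℝ)) *
          (u / δ) ^ (-((n:ℝ) / px - α) - n) := by
        rw [← Real.rpow_add hu, ← Real.rpow_add hδ, ← sub_eq_add_neg,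
          ← Real.mul_rpow hδ.le huδ.le]
        congr 1
        · field_simp
        · ring
      rw [this]
      gcongr 1
      exact Real.rpow_le_rpow_of_exponent_le (not_lt.1 h1) (by linarith)
    have e3 : u ^ ((n:ℝ) - n / px) * u ^ (α - n) ≤ δ ^ (-((n:ℝ) / px - α)) := by
      rw [← Real.rpow_add hu]
      have : ((n:ℝ) - n / px) + (α - n) = -((n:ℝ) / px - α) := by ring
      rw [this]
      exact Real.rpow_le_rpow_of_nonpos hδ h (by linarith)
    calc g * u ^ (α - n) ≤ (u ^ (-((n:ℝ) / px)) + Real.exp (n * c1) * u ^ ((n:ℝ) - n / px) * g ^ py)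
          * u ^ (α - n) := by gcongr
      _ = u ^ (-((n:ℝ) / px)) * u ^ (α - n) +
          Real.exp (n * c1) * (u ^ ((n:ℝ) - n / px) * u ^ (α - n)) * g ^ py := by ring
      _ ≤ δ ^ (-((n:ℝ) / px - α)) * δ ^ (-(n:ℝ)) * (u / δ) ^ (-b - n) +
          Real.exp (n * c1) * δ ^ (-((n:ℝ) / px - α)) * g ^ py := by gcongr
      _ = _ := by ring

lemma rwPhi_nonneg (n : ℕ) (a b : ℝ) {ρ : ℝ} (h : 0 ≤ ρ) : 0 ≤ rwPhi n a b ρ := by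
  unfold rwPhi; split_ifs <;> positivity

lemma rwPsi_nonneg (n : ℕ) (a : ℝ) {ρ : ℝ} (h : 0 ≤ ρ) : 0 ≤ rwPsi n a ρ := by
  unfold rwPsi; split_ifs <;> positivity

/-- Pointwise estimate on the level set. -/
lemma rw_S {n : ℕ} (Ω : Set (EuclideanSpace ℝ (Fin n))) (hΩo : IsOpen Ω)
    (p α g : EuclideanSpace ℝ (Fin n) → ℝ) (hpm : Measurable p) (hgm : Measurable g)
    (hg0 : ∀ x, 0 ≤ g x)
    (hp1 : ∀ x ∈ Ω, 1 ≤ p x) {am b δ κ c1 c2 K J t : ℝ} (hb0 : 0 < b)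
    (x : EuclideanSpace ℝ (Fin n)) (hx : x ∈ Ω) (hδ : 0 < δ)
    (hα : am ≤ α x) (hb : b ≤ n / p x - α x)
    (H1 : ∀ y ∈ Ω, δ ≤ dist x y → |Real.log (dist x y)| * |p x - p y| ≤ c1)
    (H2 : ∀ y ∈ Ω, dist x y < δ → |Real.log δ| * |p x - p y| ≤ c2)
    (hJ0 : 0 ≤ J) (hK0 : 0 ≤ K)
    (hJ : ∫⁻ z : EuclideanSpace ℝ (Fin n), ENNReal.ofReal (rwPhi n am b ‖z‖) ≤ ENNReal.ofReal J)
    (hK : ∫⁻ y in Ω, ENNReal.ofReal (g y ^ p y) ≤ ENNReal.ofReal K)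
    (hκ1 : 1 ≤ κ) (hκ : J + Real.exp (n * c1) * K + 1 ≤ κ ^ b)
    (ht : t = κ ^ ((n:ℝ) / p x - α x) * δ ^ (-((n:ℝ) / p x - α x)))
    (hr : ENNReal.ofReal t < riesz Ω α g x) :
    1 ≤ ENNReal.ofReal (Real.exp (n * c2)) *
      ∫⁻ y in Ω, ENNReal.ofReal (g y ^ p y) * ENNReal.ofReal (rwPsi n am (dist x y / δ)) := by
  set N := (n:ℝ) / p x - α x with hN
  set X := ∫⁻ y in Ω, ENNReal.ofReal (g y ^ p y) * ENNReal.ofReal (rwPsi n am (dist x y / δ))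
    with hX
  have hΦm := rwPhi_meas n am b
  have hΨm := rwPsi_meas n am
  have hle : riesz Ω α g x ≤ ENNReal.ofReal (δ ^ (-N)) * (ENNReal.ofReal J +
      ENNReal.ofReal (Real.exp (n * c1)) * ENNReal.ofReal K +
      ENNReal.ofReal (Real.exp (n * c2)) * X) := by
    unfold riesz
    calc ∫⁻ y in Ω, ENNReal.ofReal (|g y| / dist x y ^ ((n : ℝ) - α x))
        ≤ ∫⁻ y in Ω, ENNReal.ofReal (δ ^ (-N)) *
          (ENNReal.ofReal ((δ ^ n)⁻¹) * ENNReal.ofReal (rwPhi n am b (dist x y / δ)) +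
          ENNReal.ofReal (Real.exp (n * c1)) * ENNReal.ofReal (g y ^ p y) +
          ENNReal.ofReal (Real.exp (n * c2)) *
            (ENNReal.ofReal (g y ^ p y) * ENNReal.ofReal (rwPsi n am (dist x y / δ)))) := by
          apply setLIntegral_mono_ae' hΩo.measurableSet
          apply ae_of_all
          intro y hy
          have hd : 0 ≤ dist x y / δ := by positivity
          have i1 := rwPhi_nonneg n am b hd
          have i2 := rwPsi_nonneg n am hd
          have i3 : 0 ≤ g y ^ p y := Real.rpow_nonneg (hg0 y) _
          rw [← ENNReal.ofReal_mul (by positivity), ← ENNReal.ofReal_mul (by positivity),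
            ← ENNReal.ofReal_mul (by positivity), ← ENNReal.ofReal_mul (by positivity),
            ← ENNReal.ofReal_add (by positivity) (by positivity),
            ← ENNReal.ofReal_add (by positivity) (by positivity),
            ← ENNReal.ofReal_mul (by positivity)]
          apply ENNReal.ofReal_le_ofReal
          rw [abs_of_nonneg (hg0 y)]
          by_cases hxy : dist x y = 0
          · have hα' : (n:ℝ) - α x ≠ 0 := by
              have h1 : (n:ℝ) / p x ≤ n := div_le_self (by positivity) (hp1 x hx)
              linarith
            rw [hxy, Real.zero_rpow hα', div_zero]
            rw [hxy] at i1 i2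
            positivity
          · have hu : 0 < dist x y := lt_of_le_of_ne dist_nonneg (Ne.symm hxy)
            exact rw_point hδ hu hα hb hb0 (hp1 x hx) (hp1 y hy) (H1 y hy) (H2 y hy) (hg0 y)
      _ = ENNReal.ofReal (δ ^ (-N)) * (ENNReal.ofReal ((δ ^ n)⁻¹) *
            (∫⁻ y in Ω, ENNReal.ofReal (rwPhi n am b (dist x y / δ))) +
          ENNReal.ofReal (Real.exp (n * c1)) * (∫⁻ y in Ω, ENNReal.ofReal (g y ^ p y)) +
          ENNReal.ofReal (Real.exp (n * c2)) * X) := by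
          rw [lintegral_const_mul _ (by fun_prop), lintegral_add_left (by fun_prop),
            lintegral_add_left (by fun_prop), lintegral_const_mul _ (by fun_prop),
            lintegral_const_mul _ (by fun_prop), lintegral_const_mul _ (by fun_prop)]
      _ ≤ _ := by
          gcongr
          calc ENNReal.ofReal ((δ ^ n)⁻¹) *
                (∫⁻ y in Ω, ENNReal.ofReal (rwPhi n am b (dist x y / δ)))
              ≤ ENNReal.ofReal ((δ ^ n)⁻¹) *
                (∫⁻ y, ENNReal.ofReal (rwPhi n am b (dist x y / δ))) := by
                gcongr; exact Measure.restrict_le_self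
            _ = ∫⁻ z : EuclideanSpace ℝ (Fin n), ENNReal.ofReal (rwPhi n am b ‖z‖) := by
                rw [rw_scale (fun ρ => ENNReal.ofReal (rwPhi n am b ρ)) (by fun_prop) x hδ,
                  ← mul_assoc, ← ENNReal.ofReal_mul (by positivity),
                  inv_mul_cancel₀ (by positivity)]
                simp
            _ ≤ _ := hJ
  by_contra hc
  push Not at hc
  have h2 : ENNReal.ofReal (δ ^ (-N)) * (ENNReal.ofReal J +
      ENNReal.ofReal (Real.exp (n * c1)) * ENNReal.ofReal K +
      ENNReal.ofReal (Real.exp (n * c2)) * X) ≤ ENNReal.ofReal t := by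
    calc _ ≤ ENNReal.ofReal (δ ^ (-N)) * (ENNReal.ofReal J +
      ENNReal.ofReal (Real.exp (n * c1)) * ENNReal.ofReal K + 1) := by gcongr
      _ = ENNReal.ofReal (δ ^ (-N) * (J + Real.exp (n * c1) * K + 1)) := by
        rw [← ENNReal.ofReal_mul (by positivity), ← ENNReal.ofReal_add (by positivity) (by positivity),
          ← ENNReal.ofReal_one, ← ENNReal.ofReal_add (by positivity) (by positivity),
          ← ENNReal.ofReal_mul (by positivity)]
      _ ≤ ENNReal.ofReal t := by
        apply ENNReal.ofReal_le_ofReal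
        rw [ht, mul_comm]
        gcongr
        exact hκ.trans (Real.rpow_le_rpow_of_exponent_le hκ1 hb)
  exact absurd (hr.trans_le (hle.trans h2)) (lt_irrefl _)

/-- The reciprocal exponent `p / (n - α p)`. -/
noncomputable def rwNu (n : ℕ) (p α : EuclideanSpace ℝ (Fin n) → ℝ)
    (x : EuclideanSpace ℝ (Fin n)) : ℝ := p x / ((n:ℝ) - α x * p x)

/-- The local scales at two close points are comparable. -/
lemma rw_compare {n : ℕ} (Ω : Set (EuclideanSpace ℝ (Fin n)))
    (p α : EuclideanSpace ℝ (Fin n) → ℝ)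
    (cp : ℝ) (hp : LogHolderWith cp p Ω) (cα : ℝ) (hα : LogHolderWith cα α Ω)
    (hp1 : ∀ x ∈ Ω, 1 ≤ p x) (pp : ℝ) (hpp : ∀ x ∈ Ω, p x ≤ pp)
    (am : ℝ) (ham : 0 < am) (hαm : ∀ x ∈ Ω, am ≤ α x)
    (A : ℝ) (hA : A < n) (hαp : ∀ x ∈ Ω, α x * p x ≤ A) (κ : ℝ) (hκ : 1 ≤ κ) :
    ∃ lam : ℝ, ∀ t : ℝ, 1 ≤ t → ∀ x ∈ Ω, ∀ y ∈ Ω, dist x y ≤ κ * t ^ (-rwNu n p α x) →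
      κ * t ^ (-rwNu n p α x) ≤ Real.exp lam * (κ * t ^ (-rwNu n p α y)) ∧
      κ * t ^ (-rwNu n p α y) ≤ Real.exp lam * (κ * t ^ (-rwNu n p α x)) := by
  set X : ℝ → ℝ := fun c => n * (Real.log κ * |c| + |c| * (1 + Real.log κ)) with hX
  refine ⟨(n * X cp + pp ^ 2 * X cα) / ((n:ℝ) - A) ^ 2, ?_⟩
  intro t ht x hx y hy hd
  set lam := (n * X cp + pp ^ 2 * X cα) / ((n:ℝ) - A) ^ 2 with hlam
  have ht0 : 0 < t := by linarith
  have hκ0 : 0 < κ := by linarith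
  have hlκ : 0 ≤ Real.log κ := Real.log_nonneg hκ
  have hlt : 0 ≤ Real.log t := Real.log_nonneg ht
  have hpx := hp1 x hx
  have hpy := hp1 y hy
  have hDx : 0 < (n:ℝ) - A := by linarith
  have hDx1 : (n:ℝ) - A ≤ (n:ℝ) - α x * p x := by linarith [hαp x hx]
  have hDy1 : (n:ℝ) - A ≤ (n:ℝ) - α y * p y := by linarith [hαp y hy]
  have hνx : 0 < rwNu n p α x := by unfold rwNu; apply div_pos <;> linarith
  set δ := κ * t ^ (-rwNu n p α x) with hδ
  have hδ0 : 0 < δ := by positivity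
  have hδκ : δ ≤ κ := by
    rw [hδ]
    apply mul_le_of_le_one_right hκ0.le
    exact Real.rpow_le_one_of_one_le_of_nonpos ht (by linarith)
  have hlogδ : Real.log δ = Real.log κ - rwNu n p α x * Real.log t := by
    rw [hδ, Real.log_mul hκ0.ne' (by positivity), Real.log_rpow ht0]; ring
  have hinv : 1 ≤ n * rwNu n p α x := by
    unfold rwNu
    rw [← mul_div_assoc, le_div_iff₀ (by linarith)]
    have : 0 ≤ α x * p x := mul_nonneg (by linarith [hαm x hx]) (by linarith)
    have : (n:ℝ) * 1 ≤ n * p x := by gcongr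
    linarith
  have hlogt : Real.log t ≤ n * (Real.log κ + |Real.log δ|) := by
    have h1 : rwNu n p α x * Real.log t ≤ Real.log κ + |Real.log δ| := by
      linarith [neg_abs_le (Real.log δ)]
    calc Real.log t = 1 * Real.log t := (one_mul _).symm
      _ ≤ n * rwNu n p α x * Real.log t := by gcongr
      _ = n * (rwNu n p α x * Real.log t) := by ring
      _ ≤ _ := by gcongr
  have hX' : ∀ (c : ℝ) (q : EuclideanSpace ℝ (Fin n) → ℝ), LogHolderWith c q Ω →
      Real.log t * |q x - q y| ≤ X c := by
    intro c q hq
    obtain ⟨h1, h2⟩ := rw_lh hq hx hy hδ0 hd hδκ hκ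
    calc Real.log t * |q x - q y| ≤ n * (Real.log κ + |Real.log δ|) * |q x - q y| := by gcongr
      _ = n * (Real.log κ * |q x - q y| + |Real.log δ| * |q x - q y|) := by ring
      _ ≤ X c := by simp only [hX]; gcongr
  have hν : |rwNu n p α x - rwNu n p α y| ≤
      (n * |p x - p y| + pp ^ 2 * |α x - α y|) / ((n:ℝ) - A) ^ 2 := by
    have e : rwNu n p α x - rwNu n p α y = (n * (p x - p y) + p x * p y * (α x - α y)) /
        (((n:ℝ) - α x * p x) * ((n:ℝ) - α y * p y)) := by
      unfold rwNu
      rw [div_sub_div _ _ (by linarith) (by linarith)]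
      congr 1; ring
    rw [e, abs_div]
    have hpp' : p x * p y ≤ pp ^ 2 := by
      rw [sq]; exact mul_le_mul (hpp x hx) (hpp y hy) (by linarith) (by linarith [hpp x hx])
    apply div_le_div₀ (by positivity) _ (by positivity) _
    · refine (abs_add_le _ _).trans ?_
      rw [abs_mul, abs_mul, abs_of_nonneg (by positivity : (0:ℝ) ≤ n),
        abs_of_nonneg (by positivity : (0:ℝ) ≤ p x * p y)]
      gcongr
    · rw [abs_of_pos (mul_pos (by linarith) (by linarith)), sq]
      gcongr
      linarith
  have hfin : Real.log t * |rwNu n p α x - rwNu n p α y| ≤ lam := by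
    calc Real.log t * |rwNu n p α x - rwNu n p α y| ≤ Real.log t *
          ((n * |p x - p y| + pp ^ 2 * |α x - α y|) / ((n:ℝ) - A) ^ 2) := by gcongr
      _ = (n * (Real.log t * |p x - p y|) + pp ^ 2 * (Real.log t * |α x - α y|)) /
          ((n:ℝ) - A) ^ 2 := by ring
      _ ≤ lam := by
        rw [hlam]
        have h1 := hX' cp p hp
        have h2 := hX' cα α hα
        gcongr
  have key : ∀ a b : ℝ, Real.log t * |a - b| ≤ lam →
      κ * t ^ (-a) ≤ Real.exp lam * (κ * t ^ (-b)) := by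
    intro a b hab
    have : t ^ (-a) ≤ Real.exp lam * t ^ (-b) := by
      rw [Real.rpow_def_of_pos ht0, Real.rpow_def_of_pos ht0, ← Real.exp_add]
      apply Real.exp_le_exp.2
      have : Real.log t * (b - a) ≤ Real.log t * |a - b| := by
        gcongr; rw [abs_sub_comm]; exact le_abs_self _
      linarith
    calc κ * t ^ (-a) ≤ κ * (Real.exp lam * t ^ (-b)) := by gcongr
      _ = _ := by ring
  refine ⟨key _ _ hfin, key _ _ ?_⟩
  rw [abs_sub_comm]; exact hfin

lemma rw_core {n : ℕ} (hn : 1 ≤ n)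
    (Ω : Set (EuclideanSpace ℝ (Fin n))) (hΩo : IsOpen Ω)
    (hΩb : Bornology.IsBounded Ω)
    (p α : EuclideanSpace ℝ (Fin n) → ℝ) (hpm : Measurable p) (hαmeas : Measurable α)
    (cp : ℝ) (hp : LogHolderWith cp p Ω) (cα : ℝ) (hα : LogHolderWith cα α Ω)
    (hp1 : ∀ x ∈ Ω, 1 ≤ p x) (pp : ℝ) (hpp : ∀ x ∈ Ω, p x ≤ pp)
    (am : ℝ) (ham : 0 < am) (hαm : ∀ x ∈ Ω, am ≤ α x)
    (A : ℝ) (hA : A < n) (hαp : ∀ x ∈ Ω, α x * p x ≤ A) :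
    ∃ c : ℝ, 0 < c ∧
      ∀ g : EuclideanSpace ℝ (Fin n) → ℝ, Measurable g → (∀ x, 0 ≤ g x) →
      (∫⁻ y in Ω, ENNReal.ofReal (g y ^ p y) ≤ ENNReal.ofReal (2 ^ pp)) →
      ∀ t : ℝ, 0 < t →
        (∫⁻ x in {x | x ∈ Ω ∧ riesz Ω α g x > ENNReal.ofReal t},
            ENNReal.ofReal (t ^ ((n : ℝ) * p x / ((n : ℝ) - α x * p x))))
          ≤ ENNReal.ofReal c * (∫⁻ y in Ω, ENNReal.ofReal (g y ^ p y))
            + ENNReal.ofReal c * volume {x | x ∈ Ω ∧ 0 < g x ∧ g x < 1} := by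
  rcases Ω.eq_empty_or_nonempty with hem | ⟨x0, hx0⟩
  · refine ⟨1, one_pos, ?_⟩
    intro g _ _ _ t _
    subst hem
    simp
  have hαn : ∀ x ∈ Ω, α x < n := by
    intro x hx
    have h1 := hαp x hx
    have h2 := hαm x hx
    have h3 := hp1 x hx
    nlinarith
  have hamn : am ≤ n := (hαm x0 hx0).trans (hαn x0 hx0).le
  have hpp1 : 1 ≤ pp := (hp1 x0 hx0).trans (hpp x0 hx0)
  obtain ⟨R, hR1, hR⟩ : ∃ R : ℝ, 1 ≤ R ∧ ∀ x ∈ Ω, ∀ y ∈ Ω, dist x y < R := by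
    obtain ⟨C, hC⟩ := Metric.isBounded_iff.1 hΩb
    refine ⟨max C 0 + 1, by linarith [le_max_right C 0], ?_⟩
    intro x hx y hy
    linarith [hC hx hy, le_max_left C 0]
  set b := ((n:ℝ) - A) / pp with hb
  have hb0 : 0 < b := div_pos (by linarith) (by linarith)
  set Jr := ∫ z : EuclideanSpace ℝ (Fin n), rwPhi n am b ‖z‖ with hJr
  have hJ : ∫⁻ z : EuclideanSpace ℝ (Fin n), ENNReal.ofReal (rwPhi n am b ‖z‖) =
      ENNReal.ofReal Jr := by
    rw [hJr, ofReal_integral_eq_lintegral_ofReal (rwPhi_integrable hn ham hb0)]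
    exact ae_of_all _ fun z => rwPhi_nonneg _ _ _ (norm_nonneg z)
  have hJ0 : 0 ≤ Jr := integral_nonneg fun z => rwPhi_nonneg _ _ _ (norm_nonneg z)
  have hJ2 : ∫⁻ z : EuclideanSpace ℝ (Fin n), ENNReal.ofReal (rwPsi n am ‖z‖) ≤
      ENNReal.ofReal Jr := by
    rw [← hJ]
    exact lintegral_mono fun z => ENNReal.ofReal_le_ofReal (rwPsi_le_Phi _ _ _ (norm_nonneg z))
  have hΨm := rwPsi_meas n am
  set c1 := |cp| * (1 + Real.log R) with hc1
  set κ := (Jr + Real.exp (n * c1) * 2 ^ pp + 1) ^ (1 / b) with hκ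
  have hbase : 1 ≤ Jr + Real.exp (n * c1) * 2 ^ pp + 1 := by
    have : 0 ≤ Real.exp (n * c1) * 2 ^ pp := by positivity
    linarith
  have hκ1 : 1 ≤ κ := Real.one_le_rpow hbase (by positivity)
  have hκ0 : 0 < κ := by linarith
  have hκb : Jr + Real.exp (n * c1) * 2 ^ pp + 1 ≤ κ ^ b := by
    rw [hκ, ← Real.rpow_mul (by linarith), one_div, inv_mul_cancel₀ hb0.ne', Real.rpow_one]
  set c2 := |cp| * (1 + Real.log κ) with hc2
  obtain ⟨lam, hcomp⟩ := rw_compare Ω p α cp hp cα hα hp1 pp hpp am ham hαm A hA hαp κ hκ1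
  set Λ := Real.exp lam with hΛ
  have hΛ0 : 0 < Λ := Real.exp_pos _
  set B := κ ^ n * Real.exp (n * c2) * (Λ ^ 2) ^ n with hB
  have hB0 : 0 ≤ B := by positivity
  refine ⟨B * Jr + R ^ n * Jr + 1, by positivity, ?_⟩
  intro g hgm hg0 hK t ht
  set G := ∫⁻ y in Ω, ENNReal.ofReal (g y ^ p y) with hG
  have hνdef : ∀ x, (n : ℝ) * p x / ((n : ℝ) - α x * p x) = n * rwNu n p α x := by
    intro x; unfold rwNu; ring
  simp only [hνdef]
  have hνm : Measurable (rwNu n p α) := by unfold rwNu; fun_prop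
  have hΩm := hΩo.measurableSet
  rcases le_or_gt t 1 with ht1 | ht1
  · -- small t
    set W : EuclideanSpace ℝ (Fin n) → ENNReal := Ω.indicator (fun y => ENNReal.ofReal (g y))
      with hW
    have hWm : Measurable W := Measurable.indicator (by fun_prop) hΩm
    set φ : ℝ → ENNReal := fun ρ => ENNReal.ofReal (rwPsi n am ρ) with hφ
    have hφm : Measurable φ := by fun_prop
    have hpt : ∀ x ∈ {x | x ∈ Ω ∧ riesz Ω α g x > ENNReal.ofReal t},
        ENNReal.ofReal (t ^ (n * rwNu n p α x)) ≤ ∫⁻ y, W y * φ (dist x y / R) := by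
      rintro x ⟨hx, hxr⟩
      have hinv : 1 ≤ n * rwNu n p α x := by
        unfold rwNu
        have hD : 0 < (n:ℝ) - α x * p x := by linarith [hαp x hx]
        rw [← mul_div_assoc, le_div_iff₀ hD]
        have : 0 ≤ α x * p x := mul_nonneg (by linarith [hαm x hx]) (by linarith [hp1 x hx])
        have : (n:ℝ) * 1 ≤ n * p x := by gcongr; exact hp1 x hx
        linarith
      have h1 : ENNReal.ofReal (t ^ (n * rwNu n p α x)) ≤ ENNReal.ofReal t := by
        apply ENNReal.ofReal_le_ofReal
        calc t ^ (n * rwNu n p α x) ≤ t ^ (1:ℝ) :=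
              Real.rpow_le_rpow_of_exponent_ge ht ht1 hinv
          _ = t := Real.rpow_one t
      refine h1.trans (hxr.le.trans ?_)
      unfold riesz
      rw [← lintegral_indicator hΩm]
      apply lintegral_mono
      intro y
      by_cases hy : y ∈ Ω
      · simp only [hW, indicator_of_mem hy, hφ]
        rw [← ENNReal.ofReal_mul (hg0 y), abs_of_nonneg (hg0 y)]
        apply ENNReal.ofReal_le_ofReal
        have hR0 : 0 < R := by linarith
        by_cases hxy : dist x y = 0
        · rw [hxy, Real.zero_rpow (by linarith [hαn x hx]), div_zero]
          exact mul_nonneg (hg0 y) (rwPsi_nonneg _ _ (by simp))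
        · have hu : 0 < dist x y := lt_of_le_of_ne dist_nonneg (Ne.symm hxy)
          have huR : dist x y / R < 1 := by rw [div_lt_one hR0]; exact hR x hx y hy
          have huR0 : 0 < dist x y / R := by positivity
          rw [div_eq_mul_inv, ← Real.rpow_neg hu.le]
          apply mul_le_mul_of_nonneg_left _ (hg0 y)
          simp only [rwPsi, huR, if_true]
          calc dist x y ^ (-((n:ℝ) - α x)) = (R * (dist x y / R)) ^ (-((n:ℝ) - α x)) := by
                congr 1; field_simp
            _ = R ^ (-((n:ℝ) - α x)) * (dist x y / R) ^ (-((n:ℝ) - α x)) :=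
                Real.mul_rpow hR0.le huR0.le
            _ ≤ 1 * (dist x y / R) ^ (am - n) := by
                gcongr ?_ * ?_
                · exact Real.rpow_le_one_of_one_le_of_nonpos hR1 (by linarith [hαn x hx])
                · exact Real.rpow_le_rpow_of_exponent_ge huR0 huR.le (by linarith [hαm x hx])
            _ = _ := one_mul _
      · simp [indicator_of_notMem hy]
    have hHm := rw_H_meas φ hφm W hWm (fun _ => R) measurable_const
    calc ∫⁻ x in {x | x ∈ Ω ∧ riesz Ω α g x > ENNReal.ofReal t},
            ENNReal.ofReal (t ^ (n * rwNu n p α x))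
        ≤ ∫⁻ x in {x | x ∈ Ω ∧ riesz Ω α g x > ENNReal.ofReal t},
            ∫⁻ y, W y * φ (dist x y / R) := setLIntegral_mono hHm hpt
      _ ≤ ∫⁻ x, ∫⁻ y, W y * φ (dist x y / R) := setLIntegral_le_lintegral _ _
      _ = ∫⁻ y, W y * (ENNReal.ofReal (R ^ n) * ∫⁻ z : EuclideanSpace ℝ (Fin n), φ ‖z‖) :=
          rw_swap φ hφm W hWm (fun _ => R) measurable_const (fun _ => by linarith)
      _ ≤ ∫⁻ y, W y * (ENNReal.ofReal (R ^ n) * ENNReal.ofReal Jr) := by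
          gcongr
      _ = (∫⁻ y in Ω, ENNReal.ofReal (g y)) * ENNReal.ofReal (R ^ n * Jr) := by
          rw [lintegral_mul_const _ hWm, ENNReal.ofReal_mul (by positivity),
            lintegral_indicator hΩm]
      _ ≤ (G + volume {x | x ∈ Ω ∧ 0 < g x ∧ g x < 1}) * ENNReal.ofReal (R ^ n * Jr) := by
          gcongr
          have hsm : MeasurableSet {x | 0 < g x ∧ g x < 1} :=
            (measurableSet_lt measurable_const hgm).inter (measurableSet_lt hgm measurable_const)
          calc ∫⁻ y in Ω, ENNReal.ofReal (g y) ≤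
              ∫⁻ y in Ω, (ENNReal.ofReal (g y ^ p y) +
                {x | 0 < g x ∧ g x < 1}.indicator (fun _ => 1) y) := by
                apply setLIntegral_mono' hΩm
                intro y hy
                by_cases h1 : 1 ≤ g y
                · refine le_add_right (ENNReal.ofReal_le_ofReal ?_)
                  calc g y = g y ^ (1:ℝ) := (Real.rpow_one _).symm
                    _ ≤ g y ^ p y := Real.rpow_le_rpow_of_exponent_le h1 (hp1 y hy)
                · push Not at h1
                  rcases (hg0 y).eq_or_lt with h0 | h0
                  · rw [← h0]; simp
                  · have hy' : y ∈ {x | 0 < g x ∧ g x < 1} := ⟨h0, h1⟩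
                    rw [indicator_of_mem hy']
                    refine le_add_left ?_
                    simpa using h1.le
            _ = G + volume {x | x ∈ Ω ∧ 0 < g x ∧ g x < 1} := by
                rw [lintegral_add_left (by fun_prop), lintegral_indicator hsm, ← hG]
                simp only [lintegral_const, one_mul, MeasurableSet.univ, Measure.restrict_apply,
                  univ_inter]
                rw [Measure.restrict_apply hsm]
                congr 2
                ext z; simp; tauto
      _ ≤ (G + volume {x | x ∈ Ω ∧ 0 < g x ∧ g x < 1}) *
          ENNReal.ofReal (B * Jr + R ^ n * Jr + 1) := by
          gcongr
          have : 0 ≤ B * Jr := by positivity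
          linarith
      _ = _ := by ring
  · -- large t
    set δ : EuclideanSpace ℝ (Fin n) → ℝ := fun x => κ * t ^ (-rwNu n p α x) with hδ
    have hδ0 : ∀ x, 0 < δ x := fun x => by simp only [hδ]; positivity
    set r : EuclideanSpace ℝ (Fin n) → ℝ := fun x => Λ * δ x with hr
    have hr0 : ∀ x, 0 < r x := fun x => by have := hδ0 x; simp only [hr]; positivity
    have hδm : Measurable δ := by fun_prop
    have hrm : Measurable r := by fun_prop
    set W : EuclideanSpace ℝ (Fin n) → ENNReal := Ω.indicator
      (fun y => ENNReal.ofReal B * (ENNReal.ofReal ((r y ^ n)⁻¹) * ENNReal.ofReal (g y ^ p y)))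
      with hW
    have hWm : Measurable W := Measurable.indicator (by fun_prop) hΩm
    set φ : ℝ → ENNReal := fun ρ => ENNReal.ofReal (rwPsi n am ρ) with hφ
    have hφm : Measurable φ := by fun_prop
    have hpt : ∀ x ∈ {x | x ∈ Ω ∧ riesz Ω α g x > ENNReal.ofReal t},
        ENNReal.ofReal (t ^ (n * rwNu n p α x)) ≤ ∫⁻ y, W y * φ (dist x y / r y) := by
      rintro x ⟨hx, hxr⟩
      have hpx := hp1 x hx
      have hD : 0 < (n:ℝ) - α x * p x := by linarith [hαp x hx]
      have hν0 : 0 < rwNu n p α x := by unfold rwNu; apply div_pos <;> linarith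
      have hNν : (n:ℝ) / p x - α x = (rwNu n p α x)⁻¹ := by
        unfold rwNu; rw [inv_div]; field_simp
      have hbN : b ≤ (n:ℝ) / p x - α x := by
        have : (n:ℝ) / p x - α x = ((n:ℝ) - α x * p x) / p x := by field_simp
        rw [this, hb]
        exact div_le_div₀ hD.le (by linarith [hαp x hx]) (by linarith) (hpp x hx)
      have hδκ : δ x ≤ κ := by
        simp only [hδ]
        apply mul_le_of_le_one_right hκ0.le
        exact Real.rpow_le_one_of_one_le_of_nonpos ht1.le (by linarith)
      have h1 := rw_S Ω hΩo p α g hpm hgm hg0 hp1 (am := am) (b := b) (δ := δ x) (κ := κ)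
        (c1 := c1) (c2 := c2) (K := 2 ^ pp) (J := Jr) (t := t) hb0 x hx (hδ0 x) (hαm x hx) hbN
        (fun y hy hdy => (rw_lh hp hx hy (lt_of_lt_of_le (hδ0 x) hdy) le_rfl
          (hR x hx y hy).le hR1).1)
        (fun y hy hdy => (rw_lh hp hx hy (hδ0 x) hdy.le hδκ hκ1).1)
        hJ0 (by positivity) hJ.le hK hκ1 hκb
        (by
          have : κ * t ^ (-rwNu n p α x) = δ x := rfl
          rw [hNν, ← this, Real.mul_rpow hκ0.le (by positivity), ← mul_assoc,
            ← Real.rpow_add hκ0, ← Real.rpow_mul ht.le]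
          rw [add_neg_cancel, Real.rpow_zero, one_mul, neg_mul_neg, mul_inv_cancel₀ hν0.ne',
            Real.rpow_one])
        hxr
      have h2 : t ^ (n * rwNu n p α x) = κ ^ n * (δ x ^ n)⁻¹ := by
        have e : δ x ^ n = κ ^ n * t ^ (-(n * rwNu n p α x)) := by
          simp only [hδ]
          rw [mul_pow, ← Real.rpow_natCast (t ^ _), ← Real.rpow_mul ht.le]
          congr 2; ring
        rw [e, mul_inv, ← mul_assoc, mul_inv_cancel₀ (by positivity), one_mul,
          Real.rpow_neg ht.le, inv_inv]
      have hδx0 := hδ0 x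
      calc ENNReal.ofReal (t ^ (n * rwNu n p α x))
          ≤ ENNReal.ofReal (κ ^ n * (δ x ^ n)⁻¹) * (ENNReal.ofReal (Real.exp (n * c2)) *
            ∫⁻ y in Ω, ENNReal.ofReal (g y ^ p y) * ENNReal.ofReal (rwPsi n am (dist x y / δ x))) := by
            rw [h2]; exact le_mul_of_one_le_right' h1
        _ = ∫⁻ y in Ω, ENNReal.ofReal (κ ^ n * (δ x ^ n)⁻¹ * Real.exp (n * c2)) *
            (ENNReal.ofReal (g y ^ p y) * ENNReal.ofReal (rwPsi n am (dist x y / δ x))) := by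
            rw [lintegral_const_mul _ (by fun_prop), ← mul_assoc,
              ← ENNReal.ofReal_mul (by positivity)]
        _ = ∫⁻ y, Ω.indicator (fun y =>
            ENNReal.ofReal (κ ^ n * (δ x ^ n)⁻¹ * Real.exp (n * c2)) *
            (ENNReal.ofReal (g y ^ p y) * ENNReal.ofReal (rwPsi n am (dist x y / δ x)))) y := by
            rw [lintegral_indicator hΩm]
        _ ≤ ∫⁻ y, W y * φ (dist x y / r y) := by
            apply lintegral_mono
            intro y
            by_cases hy : y ∈ Ω
            · simp only [hW, indicator_of_mem hy, hφ]
              have hry := hr0 y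
              have i3 : 0 ≤ g y ^ p y := Real.rpow_nonneg (hg0 y) _
              have i1 := rwPsi_nonneg n am (ρ := dist x y / δ x) (by positivity)
              have i2 := rwPsi_nonneg n am (ρ := dist x y / r y) (by positivity)
              rw [← ENNReal.ofReal_mul (by positivity), ← ENNReal.ofReal_mul (by positivity),
                ← ENNReal.ofReal_mul (by positivity), ← ENNReal.ofReal_mul (by positivity),
                ← ENNReal.ofReal_mul (by positivity)]
              apply ENNReal.ofReal_le_ofReal
              rcases lt_or_ge (dist x y) (δ x) with hlt | hge
              · obtain ⟨k1, k2⟩ := hcomp t ht1.le x hx y hy hlt.le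
                have k1' : δ x ≤ r y := k1
                have k2' : r y ≤ Λ ^ 2 * δ x := by
                  calc r y = Λ * δ y := rfl
                    _ ≤ Λ * (Λ * δ x) := by gcongr
                    _ = _ := by ring
                have hΨ : rwPsi n am (dist x y / δ x) ≤ rwPsi n am (dist x y / r y) := by
                  rcases (dist_nonneg (x := x) (y := y)).eq_or_lt with h0 | h0
                  · rw [← h0]; simp
                  · exact rwPsi_anti hamn (by positivity) (by gcongr)
                have hpw : (δ x ^ n)⁻¹ ≤ (Λ ^ 2) ^ n * (r y ^ n)⁻¹ := by
                  rw [← div_eq_mul_inv, le_div_iff₀ (by positivity), inv_mul_le_iff₀ (by positivity),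
                    ← mul_pow]
                  rw [mul_comm (δ x)]
                  gcongr
                calc κ ^ n * (δ x ^ n)⁻¹ * Real.exp (n * c2) *
                      (g y ^ p y * rwPsi n am (dist x y / δ x))
                    ≤ κ ^ n * ((Λ ^ 2) ^ n * (r y ^ n)⁻¹) * Real.exp (n * c2) *
                      (g y ^ p y * rwPsi n am (dist x y / r y)) := by gcongr
                  _ = _ := by rw [hB]; ring
              · have : rwPsi n am (dist x y / δ x) = 0 := by
                  unfold rwPsi
                  rw [if_neg]
                  rw [not_lt, one_le_div hδx0]; exact hge
                rw [this, mul_zero, mul_zero]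
                positivity
            · simp [indicator_of_notMem hy]
    have hHm := rw_H_meas φ hφm W hWm r hrm
    calc ∫⁻ x in {x | x ∈ Ω ∧ riesz Ω α g x > ENNReal.ofReal t},
            ENNReal.ofReal (t ^ (n * rwNu n p α x))
        ≤ ∫⁻ x in {x | x ∈ Ω ∧ riesz Ω α g x > ENNReal.ofReal t},
            ∫⁻ y, W y * φ (dist x y / r y) := setLIntegral_mono hHm hpt
      _ ≤ ∫⁻ x, ∫⁻ y, W y * φ (dist x y / r y) := setLIntegral_le_lintegral _ _
      _ = ∫⁻ y, W y * (ENNReal.ofReal (r y ^ n) * ∫⁻ z : EuclideanSpace ℝ (Fin n), φ ‖z‖) :=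
          rw_swap φ hφm W hWm r hrm hr0
      _ ≤ ∫⁻ y, W y * (ENNReal.ofReal (r y ^ n) * ENNReal.ofReal Jr) := by
          gcongr
      _ = ∫⁻ y, ENNReal.ofReal (B * Jr) *
            Ω.indicator (fun y => ENNReal.ofReal (g y ^ p y)) y := by
          congr 1; ext y
          by_cases hy : y ∈ Ω
          · simp only [hW, indicator_of_mem hy]
            have hry := hr0 y
            have e : ENNReal.ofReal ((r y ^ n)⁻¹) * ENNReal.ofReal (r y ^ n) = 1 := by
              rw [← ENNReal.ofReal_mul (by positivity), inv_mul_cancel₀ (by positivity)]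
              simp
            rw [ENNReal.ofReal_mul hB0]
            calc ENNReal.ofReal B * (ENNReal.ofReal ((r y ^ n)⁻¹) * ENNReal.ofReal (g y ^ p y)) *
                  (ENNReal.ofReal (r y ^ n) * ENNReal.ofReal Jr)
                = (ENNReal.ofReal ((r y ^ n)⁻¹) * ENNReal.ofReal (r y ^ n)) *
                  (ENNReal.ofReal B * ENNReal.ofReal Jr * ENNReal.ofReal (g y ^ p y)) := by ring
              _ = _ := by rw [e, one_mul]
          · simp [hW, indicator_of_notMem hy]
      _ = ENNReal.ofReal (B * Jr) * G := by
          rw [lintegral_const_mul' _ _ ENNReal.ofReal_ne_top, lintegral_indicator hΩm]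
      _ ≤ ENNReal.ofReal (B * Jr + R ^ n * Jr + 1) * G := by
          gcongr
          have : 0 ≤ R ^ n * Jr := by positivity
          linarith
      _ ≤ _ := le_self_add

end rwHelpers

/-- Weak-type estimate for the variable order Riesz potential (Theorem 3.2). -/
theorem riesz_weak_type {n : ℕ} (hn : 1 ≤ n)
    (Ω : Set (EuclideanSpace ℝ (Fin n))) (hΩo : IsOpen Ω)
    (hΩb : Bornology.IsBounded Ω)
    (p α : EuclideanSpace ℝ (Fin n) → ℝ)
    (cp : ℝ) (hp : LogHolderWith cp p Ω) (cα : ℝ) (hα : LogHolderWith cα α Ω)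
    (hp1 : ∀ x ∈ Ω, 1 ≤ p x) (pp : ℝ) (hpp : ∀ x ∈ Ω, p x ≤ pp)
    (am : ℝ) (ham : 0 < am) (hαm : ∀ x ∈ Ω, am ≤ α x)
    (A : ℝ) (hA : A < n) (hαp : ∀ x ∈ Ω, α x * p x ≤ A) :
    ∃ c : ℝ, 0 < c ∧
      ∀ f : EuclideanSpace ℝ (Fin n) → ℝ, luxNorm p Ω f ≤ 1 →
      ∀ t : ℝ, 0 < t →
        (∫⁻ x in {x | x ∈ Ω ∧ riesz Ω α f x > ENNReal.ofReal t},
            ENNReal.ofReal (t ^ ((n : ℝ) * p x / ((n : ℝ) - α x * p x))))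
          ≤ ENNReal.ofReal c * (∫⁻ y in Ω, ENNReal.ofReal (|f y| ^ p y))
            + ENNReal.ofReal c * volume {x | x ∈ Ω ∧ 0 < |f x| ∧ |f x| ≤ 1} := by
  classical
  have hαn : ∀ x ∈ Ω, α x < n := by
    intro x hx
    have h1 := hαp x hx
    have h2 := hαm x hx
    have h3 := hp1 x hx
    nlinarith
  set p' : EuclideanSpace ℝ (Fin n) → ℝ := Ω.piecewise p (fun _ => 1) with hp'
  set α' : EuclideanSpace ℝ (Fin n) → ℝ := Ω.piecewise α (fun _ => 1) with hα'
  have hpe : ∀ x ∈ Ω, p' x = p x := fun x hx => Set.piecewise_eq_of_mem _ _ _ hx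
  have hαe : ∀ x ∈ Ω, α' x = α x := fun x hx => Set.piecewise_eq_of_mem _ _ _ hx
  have hpm : Measurable p' := ContinuousOn.measurable_piecewise (rw_lh_cont hp)
    continuousOn_const hΩo.measurableSet
  have hαmeas : Measurable α' := ContinuousOn.measurable_piecewise (rw_lh_cont hα)
    continuousOn_const hΩo.measurableSet
  obtain ⟨c, hc0, hc⟩ := rw_core hn Ω hΩo hΩb p' α' hpm hαmeas cp
    (fun x hx y hy hxy => by rw [hpe x hx, hpe y hy]; exact hp hx hy hxy) cα
    (fun x hx y hy hxy => by rw [hαe x hx, hαe y hy]; exact hα hx hy hxy)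
    (fun x hx => by rw [hpe x hx]; exact hp1 x hx) pp
    (fun x hx => by rw [hpe x hx]; exact hpp x hx) am ham
    (fun x hx => by rw [hαe x hx]; exact hαm x hx) A hA
    (fun x hx => by rw [hpe x hx, hαe x hx]; exact hαp x hx)
  refine ⟨c, hc0, ?_⟩
  intro f hf t ht
  rcases rw_lux Ω hΩo p hp1 pp hpp f hf with htop | hK
  · rw [htop, ENNReal.mul_top (by simpa using hc0)]
    simp
  obtain ⟨g, hgm, hg0, hgf, hgr, hgv⟩ := rw_reduce hn Ω hΩo hΩb α hαn f
  have hGle : ∫⁻ y in Ω, ENNReal.ofReal (g y ^ p' y) ≤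
      ∫⁻ y in Ω, ENNReal.ofReal (|f y| ^ p y) := by
    apply setLIntegral_mono' hΩo.measurableSet
    intro y hy
    rw [hpe y hy]
    apply ENNReal.ofReal_le_ofReal
    exact Real.rpow_le_rpow (hg0 y) (hgf y) (by linarith [hp1 y hy])
  have hmain := hc g hgm hg0 (hGle.trans hK) t ht
  have hsub : {x | x ∈ Ω ∧ riesz Ω α f x > ENNReal.ofReal t} ⊆
      {x | x ∈ Ω ∧ riesz Ω α' g x > ENNReal.ofReal t} := by
    rintro x ⟨hx, hxr⟩
    refine ⟨hx, lt_of_lt_of_le hxr ((hgr x hx).trans ?_)⟩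
    unfold riesz
    rw [hαe x hx]
  calc ∫⁻ x in {x | x ∈ Ω ∧ riesz Ω α f x > ENNReal.ofReal t},
            ENNReal.ofReal (t ^ ((n : ℝ) * p x / ((n : ℝ) - α x * p x)))
      ≤ ∫⁻ x in {x | x ∈ Ω ∧ riesz Ω α f x > ENNReal.ofReal t},
            ENNReal.ofReal (t ^ ((n : ℝ) * p' x / ((n : ℝ) - α' x * p' x))) := by
        apply setLIntegral_mono
        · fun_prop
        · rintro x ⟨hx, -⟩
          rw [hpe x hx, hαe x hx]
    _ ≤ ∫⁻ x in {x | x ∈ Ω ∧ riesz Ω α' g x > ENNReal.ofReal t},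
            ENNReal.ofReal (t ^ ((n : ℝ) * p' x / ((n : ℝ) - α' x * p' x))) :=
        lintegral_mono_set hsub
    _ ≤ _ := hmain
    _ ≤ _ := by gcongr
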